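/- Let K be a field of characteristic p > 0 with a normalized discrete valuation v. Let f ∈ K with v(f) > 0 such that the polynomial T^p − T − f has no root in K, and let L = K_{℘,f} be its splitting field (a degree p Galois extension of K). Then every extension v_L of v to L has ramification index e(v_L|v) = 1 and residue degree f(v_L|v) = 1, and there are exactly p distinct extensions of v to L; equivalently, the integral closure of 𝒪_K in L has exactly p maximal ideals, each unramified with trivial residue extension over the maximal ideal of 𝒪_K. -/

import Mathlib

open Polynomial

/-- `v` is a *normalized* discrete (additive) valuation on a field `K`:
it attains every integer value (i.e. `v : K^× → ℤ` is surjective). -/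
def IsNormalizedVal {K : Type*} [Field K] (v : AddValuation K (WithTop ℤ)) : Prop :=
  ∀ n : ℤ, ∃ x : K, v x = (n : WithTop ℤ)

/-- The valuation `w` on `L` extends the valuation `v` on `K` with ramification index `e`,
i.e. the restriction of `w` to `K^×` equals `e • v`. -/
def ExtendsWith {K L : Type*} [Field K] [Field L] [Algebra K L]
    (v : AddValuation K (WithTop ℤ)) (w : AddValuation L (WithTop ℤ)) (e : ℤ) : Prop :=
  ∀ (x : K) (n : ℤ), v x = (n : WithTop ℤ) →
    w (algebraMap K L x) = ((e * n : ℤ) : WithTop ℤ)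

/-- `u ∈ L` lies in the integral closure in `L` of the valuation ring
`𝒪_K = {x : K | 0 ≤ v x}` : it is a root of a monic polynomial with coefficients in `𝒪_K`. -/
def MemIntegralClosureOfVal {K L : Type*} [Field K] [Field L] [Algebra K L]
    (v : AddValuation K (WithTop ℤ)) (u : L) : Prop :=
  ∃ g : Polynomial K, g.Monic ∧ (∀ i, (0 : WithTop ℤ) ≤ v (g.coeff i)) ∧
    Polynomial.aeval u g = 0

/-- `w` is a normalized discrete valuation on `L` extending the valuation `v` of `K`
(with some positive ramification index). -/
def IsNormExtension {K L : Type*} [Field K] [Field L] [Algebra K L]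
    (v : AddValuation K (WithTop ℤ)) (w : AddValuation L (WithTop ℤ)) : Prop :=
  IsNormalizedVal w ∧ ∃ e : ℤ, 0 < e ∧ ExtendsWith v w e

/-- The residue field extension of `w` over `v` is trivial, i.e. the residue degree
`f(w|v)` equals `1`: every integer of `w` is congruent mod the maximal ideal to an
integer of `v`. -/
def ResidueDegreeOne {K L : Type*} [Field K] [Field L] [Algebra K L]
    (v : AddValuation K (WithTop ℤ)) (w : AddValuation L (WithTop ℤ)) : Prop :=
  ∀ y : L, 0 ≤ w y → ∃ x : K, 0 ≤ v x ∧ 0 < w (y - algebraMap K L x)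

/-- The residue degree `f(w|v)` equals `d`: there is an integer `y` of `w` whose residue
powers `1, ȳ, …, ȳ^{d-1}` span the residue field of `w` over that of `v` (first clause)
and are linearly independent over it (second clause). -/
def ResidueDegreeEq {K L : Type*} [Field K] [Field L] [Algebra K L]
    (v : AddValuation K (WithTop ℤ)) (w : AddValuation L (WithTop ℤ)) (d : ℕ) : Prop :=
  ∃ y : L, 0 ≤ w y ∧
    (∀ z : L, 0 ≤ w z → ∃ c : Fin d → K, (∀ i, 0 ≤ v (c i)) ∧
      0 < w (z - ∑ i : Fin d, algebraMap K L (c i) * y ^ (i : ℕ))) ∧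
    (∀ c : Fin d → K, (∀ i, 0 ≤ v (c i)) →
      0 < w (∑ i : Fin d, algebraMap K L (c i) * y ^ (i : ℕ)) → ∀ i, 0 < v (c i))

section Field

variable {K L : Type*} [Field K] [Field L] [Algebra K L] {p : ℕ}

lemma natDegree_X_pow_sub_X_sub_C (f : K) (hp : 1 < p) :
    (X ^ p - X - C f : K[X]).natDegree = p := by
  rw [sub_sub]
  refine (natDegree_sub_eq_left_of_natDegree_lt ?_).trans (natDegree_X_pow p)
  rw [natDegree_X_pow, natDegree_X_add_C]
  exact hp

lemma monic_X_pow_sub_X_sub_C (f : K) (hp : 1 < p) : (X ^ p - X - C f : K[X]).Monic := by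
  rw [sub_sub]
  apply monic_X_pow_sub
  rw [degree_X_add_C]
  exact_mod_cast hp

/-- Elements fixed by the `p`-power map lie in the base field. -/
lemma exists_algebraMap_eq_of_pow_eq_self [Fact p.Prime] [CharP L p] {z : L} (hz : z ^ p = z) :
    ∃ c : K, algebraMap K L c = z := by
  have h : z ∈ (⊥ : Subfield L) := (Subfield.mem_bot_iff_pow_eq_self L p).2 hz
  exact (bot_le : (⊥ : Subfield L) ≤ (algebraMap K L).fieldRange) h

lemma sub_pow_eq_sub_of_pow_sub_self [Fact p.Prime] [CharP L p] {a b c : L}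
    (ha : a ^ p - a = c) (hb : b ^ p - b = c) :
    (a - b) ^ p = a - b := by
  rw [sub_pow_char]
  linear_combination ha - hb

/-- A root of an Artin–Schreier polynomial without roots in the base field has this polynomial
as its minimal polynomial. -/
lemma minpoly_eq_of_pow_sub_self [Fact p.Prime] [CharP K p] [CharP L p] {f : K}
    (hirr : ∀ x : K, x ^ p - x ≠ f)
    (hsplit : ((X ^ p - X - C f : K[X]).map (algebraMap K L)).Splits)
    {b : L} (hb : b ^ p - b = algebraMap K L f) :
    minpoly K b = X ^ p - X - C f := by
  have hp : 1 < p := (Fact.out : p.Prime).one_lt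
  have hdeg := natDegree_X_pow_sub_X_sub_C f hp
  have hmon := monic_X_pow_sub_X_sub_C f hp
  have hroot : aeval b (X ^ p - X - C f : K[X]) = 0 := by simp [hb]
  have hint : IsIntegral K b := ⟨_, hmon, hroot⟩
  have hdvd : minpoly K b ∣ X ^ p - X - C f := minpoly.dvd K b hroot
  refine (eq_of_monic_of_dvd_of_natDegree_le (minpoly.monic hint) hmon hdvd ?_).symm
  rw [hdeg]
  by_contra! hlt
  have hs : ((minpoly K b).map (algebraMap K L)).Splits :=
    hsplit.of_dvd (map_ne_zero hmon.ne_zero) (Polynomial.map_dvd _ hdvd)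
  have hsum : ∀ s : Multiset L, (∀ r ∈ s, r ^ p - r = algebraMap K L f) →
      ∃ c : K, s.sum = s.card * b + algebraMap K L c := by
    intro s
    induction s using Multiset.induction_on with
    | empty => exact fun _ => ⟨0, by simp⟩
    | cons a s ih =>
      intro h
      obtain ⟨c, hc⟩ := ih fun r hr => h r (Multiset.mem_cons_of_mem hr)
      obtain ⟨d, hd⟩ := exists_algebraMap_eq_of_pow_eq_self (K := K)
        (sub_pow_eq_sub_of_pow_sub_self (h a (Multiset.mem_cons_self a s)) hb)
      refine ⟨d + c, ?_⟩
      rw [Multiset.sum_cons, Multiset.card_cons, hc, map_add, hd]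
      push_cast
      ring
  obtain ⟨c, hc⟩ := hsum ((minpoly K b).map (algebraMap K L)).roots fun r hr => by
    have h1 : aeval r (minpoly K b) = 0 := by
      simpa [aeval_def, eval_map] using (mem_roots'.1 hr).2
    have h2 : aeval r (X ^ p - X - C f : K[X]) = 0 := aeval_eq_zero_of_dvd_aeval_eq_zero hdvd h1
    simp only [map_sub, map_pow, aeval_X, aeval_C] at h2
    exact sub_eq_zero.1 h2
  have hn := hs.nextCoeff_eq_neg_sum_roots_of_monic ((minpoly.monic hint).map _)
  rw [hc, ← hs.natDegree_eq_card_roots, natDegree_map,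
    nextCoeff_map (algebraMap K L).injective] at hn
  set d := (minpoly K b).natDegree with hd
  have hd0 : (d : K) ≠ 0 := by
    rw [Ne, CharP.cast_eq_zero_iff K p]
    exact fun h => absurd (Nat.le_of_dvd (minpoly.natDegree_pos hint) h) (by omega)
  have hb' : b = algebraMap K L (-((minpoly K b).nextCoeff + c) / d) := by
    have : (d : L) ≠ 0 := by simpa using (map_ne_zero (algebraMap K L)).2 hd0
    simp only [map_div₀, map_neg, map_add, map_natCast]
    rw [eq_div_iff this]
    linear_combination hn
  apply hirr (-((minpoly K b).nextCoeff + c) / d)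
  apply (algebraMap K L).injective
  rw [map_sub, map_pow, ← hb', hb]

lemma aeval_surjective_of_pow_sub_self [Fact p.Prime] [CharP L p] {f : K}
    (hL : IsSplittingField K L (X ^ p - X - C f : K[X]))
    {b : L} (hb : b ^ p - b = algebraMap K L f) :
    ∀ y : L, ∃ g : K[X], aeval b g = y := by
  have h : Algebra.adjoin K ((X ^ p - X - C f : K[X]).rootSet L) ≤
      (aeval b : K[X] →ₐ[K] L).range := by
    refine Algebra.adjoin_le fun r hr => ?_
    have hr : aeval r (X ^ p - X - C f : K[X]) = 0 := (mem_rootSet'.1 hr).2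
    simp only [map_sub, map_pow, aeval_X, aeval_C] at hr
    obtain ⟨c, hc⟩ := exists_algebraMap_eq_of_pow_eq_self (K := K)
      (sub_pow_eq_sub_of_pow_sub_self (sub_eq_zero.1 hr) hb)
    exact ⟨X + C c, by simp [hc]⟩
  rw [hL.adjoin_rootSet] at h
  exact fun y => h (Algebra.mem_top : y ∈ (⊤ : Subalgebra K L))

lemma ncard_pow_sub_self [Fact p.Prime] [CharP K p] {f : K}
    (hsplit : ((X ^ p - X - C f : K[X]).map (algebraMap K L)).Splits) :
    {b : L | b ^ p - b = algebraMap K L f}.ncard = p := by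
  have hp : 1 < p := (Fact.out : p.Prime).one_lt
  have hdeg := natDegree_X_pow_sub_X_sub_C f hp
  have hne : (X ^ p - X - C f : K[X]) ≠ 0 := by
    rintro h
    rw [h] at hdeg
    simp at hdeg
    omega
  have hset : {b : L | b ^ p - b = algebraMap K L f} = (X ^ p - X - C f : K[X]).rootSet L := by
    ext b
    rw [mem_rootSet_of_ne hne]
    simp [sub_eq_zero]
  have hsep : (X ^ p - X - C f : K[X]).Separable := by
    have : derivative (X ^ p - X - C f : K[X]) = -1 := by
      simp [derivative_X_pow, CharP.cast_eq_zero]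
    rw [Separable, this]
    exact isCoprime_one_right.neg_right
  rw [hset, ← Nat.card_coe_set_eq, Nat.card_eq_fintype_card,
    card_rootSet_eq_natDegree hsep hsplit, hdeg]

end Field

section Valuation

variable {K L : Type*} [Field K] [Field L] [Algebra K L]

lemma AddValuation.exists_int_eq (v : AddValuation K (WithTop ℤ)) {x : K} (hx : x ≠ 0) :
    ∃ n : ℤ, v x = n := by
  obtain ⟨n, hn⟩ := WithTop.ne_top_iff_exists.1 ((AddValuation.ne_top_iff v).2 hx)
  exact ⟨n, hn.symm⟩

lemma AddValuation.nonneg_pow (v : AddValuation K (WithTop ℤ)) {x : K} (hx : 0 ≤ v x) (n : ℕ) :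
    0 ≤ v (x ^ n) := by
  rw [AddValuation.map_pow]
  exact nsmul_nonneg hx n

lemma AddValuation.le_map_pow_sub_pow (v : AddValuation K (WithTop ℤ)) {x y : K}
    (hx : 0 ≤ v x) (hy : 0 ≤ v y) (n : ℕ) : v (x - y) ≤ v (x ^ n - y ^ n) := by
  induction n with
  | zero => simp
  | succ n ih =>
    have h : x ^ (n + 1) - y ^ (n + 1) = x * (x ^ n - y ^ n) + (x - y) * y ^ n := by ring
    rw [h]
    apply AddValuation.map_le_add
    · rw [AddValuation.map_mul]
      exact ih.trans (le_add_of_nonneg_left hx)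
    · rw [AddValuation.map_mul]
      exact le_add_of_nonneg_right (v.nonneg_pow hy n)

/-- Polynomial functions are uniformly Lipschitz on the valuation ring. -/
lemma AddValuation.exists_le_map_eval_sub_eval (v : AddValuation K (WithTop ℤ)) (g : K[X]) :
    ∃ B : ℤ, ∀ x y, 0 ≤ v x → 0 ≤ v y →
      (B : WithTop ℤ) + v (x - y) ≤ v (g.eval x - g.eval y) := by
  induction g using Polynomial.induction_on' with
  | add g h hg hh =>
    obtain ⟨B, hB⟩ := hg
    obtain ⟨C, hC⟩ := hh
    refine ⟨min B C, fun x y hx hy => ?_⟩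
    rw [eval_add, eval_add, add_sub_add_comm]
    apply AddValuation.map_le_add
    · refine le_trans ?_ (hB x y hx hy)
      gcongr
      exact WithTop.coe_le_coe.2 (min_le_left B C)
    · refine le_trans ?_ (hC x y hx hy)
      gcongr
      exact WithTop.coe_le_coe.2 (min_le_right B C)
  | monomial n a =>
    by_cases ha : a = 0
    · exact ⟨0, fun x y _ _ => by simp [ha]⟩
    · obtain ⟨B, hB⟩ := v.exists_int_eq ha
      refine ⟨B, fun x y hx hy => ?_⟩
      rw [eval_monomial, eval_monomial, ← mul_sub, AddValuation.map_mul, hB]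
      gcongr
      exact v.le_map_pow_sub_pow hx hy n

lemma AddValuation.exists_le_map_eval (v : AddValuation K (WithTop ℤ)) (g : K[X]) :
    ∃ B : ℤ, ∀ x, 0 ≤ v x → (B : WithTop ℤ) ≤ v (g.eval x) := by
  obtain ⟨B, hB⟩ := v.exists_le_map_eval_sub_eval g
  obtain ⟨C, hC⟩ : ∃ C : ℤ, (C : WithTop ℤ) ≤ v (g.eval 0) := by
    by_cases h : g.eval 0 = 0
    · exact ⟨0, by simp [h]⟩
    · obtain ⟨C, hC⟩ := v.exists_int_eq h
      exact ⟨C, hC.ge⟩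
  refine ⟨min B C, fun x hx => ?_⟩
  have h := hB x 0 hx (by simp)
  rw [← sub_add_cancel (g.eval x) (g.eval 0)]
  apply AddValuation.map_le_add
  · refine le_trans ?_ h
    rw [sub_zero]
    refine le_trans ?_ (le_add_of_nonneg_right hx)
    exact WithTop.coe_le_coe.2 (min_le_left B C)
  · refine le_trans ?_ hC
    exact WithTop.coe_le_coe.2 (min_le_right B C)

/-- Iterating the `p`-power map makes an element of positive valuation tend to `0`. -/
lemma AddValuation.natCast_lt_of_pow (v : AddValuation K (WithTop ℤ)) {p : ℕ} (hp : 1 < p)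
    {x : ℕ → K} (h0 : 0 < v (x 0)) (hx : ∀ n, x (n + 1) = x n ^ p) (n : ℕ) :
    ((n : ℤ) : WithTop ℤ) < v (x n) := by
  induction n with
  | zero => exact_mod_cast h0
  | succ n ih =>
    rw [hx, AddValuation.map_pow]
    induction hv : v (x n) with
    | top =>
      obtain ⟨q, rfl⟩ := Nat.exists_eq_succ_of_ne_zero (by omega : p ≠ 0)
      rw [succ_nsmul]
      simp
    | coe k =>
      rw [hv] at ih
      norm_cast at ih ⊢
      rw [nsmul_eq_mul]
      push_cast
      have : (2 : ℤ) ≤ p := by exact_mod_cast hp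
      nlinarith

lemma AddValuation.map_pow_ne_self (v : AddValuation K (WithTop ℤ)) {p : ℕ} (hp : 1 < p)
    {x : K} (hx : x ≠ 0) (h : 0 < v x) : x ^ p ≠ x := by
  intro hxp
  obtain ⟨k, hk⟩ := v.exists_int_eq hx
  have h1 := congrArg v hxp
  rw [AddValuation.map_pow, hk] at h1
  rw [hk] at h
  norm_cast at h h1
  rw [nsmul_eq_mul] at h1
  have : (2 : ℤ) ≤ p := by exact_mod_cast hp
  nlinarith

lemma AddValuation.exists_pos_of_multiset_prod (v : AddValuation K (WithTop ℤ)) (s : Multiset K)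
    (h : 0 < v s.prod) : ∃ r ∈ s, 0 < v r := by
  induction s using Multiset.induction_on with
  | empty => simp at h
  | cons a s ih =>
    by_cases ha : 0 < v a
    · exact ⟨a, Multiset.mem_cons_self a s, ha⟩
    · rw [Multiset.prod_cons, AddValuation.map_mul] at h
      have hs : 0 < v s.prod := by
        by_contra hs
        exact absurd h (not_lt.2 (add_nonpos (not_lt.1 ha) (not_lt.1 hs)))
      obtain ⟨r, hr, hr'⟩ := ih hs
      exact ⟨r, Multiset.mem_cons_of_mem hr, hr'⟩

lemma ExtendsWith.nonneg_iff {v : AddValuation K (WithTop ℤ)} {w : AddValuation L (WithTop ℤ)}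
    {e : ℤ} (h : ExtendsWith v w e) (he : 0 < e) (x : K) :
    0 ≤ w (algebraMap K L x) ↔ 0 ≤ v x := by
  by_cases hx : x = 0
  · simp [hx]
  · obtain ⟨n, hn⟩ := v.exists_int_eq hx
    rw [h x n hn, hn]
    norm_cast
    exact mul_nonneg_iff_of_pos_left he

lemma ExtendsWith.pos_iff {v : AddValuation K (WithTop ℤ)} {w : AddValuation L (WithTop ℤ)}
    {e : ℤ} (h : ExtendsWith v w e) (he : 0 < e) (x : K) :
    0 < w (algebraMap K L x) ↔ 0 < v x := by
  by_cases hx : x = 0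
  · simp [hx]
  · obtain ⟨n, hn⟩ := v.exists_int_eq hx
    rw [h x n hn, hn]
    norm_cast
    exact mul_pos_iff_of_pos_left he

end Valuation

section ArtinSchreierValuation

variable {K L : Type*} [Field K] [Field L] [Algebra K L] {p : ℕ}

/-- A sequence of approximate roots of `T ^ p - T - f`, namely `-∑ i < n, f ^ (p ^ i)`. -/
def approxRoot (p : ℕ) (f : K) : ℕ → K
  | 0 => 0
  | n + 1 => approxRoot p f n ^ p - f

lemma map_approxRoot_pos (v : AddValuation K (WithTop ℤ)) (hp : 1 < p) {f : K} (hf : 0 < v f)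
    (n : ℕ) : 0 < v (approxRoot p f n) := by
  induction n with
  | zero => simp [approxRoot]
  | succ n ih =>
    rw [approxRoot, sub_eq_add_neg]
    apply AddValuation.map_lt_add
    · rw [AddValuation.map_pow]
      exact nsmul_pos ih (by omega)
    · rwa [AddValuation.map_neg]

lemma lt_map_approxRoot_succ_sub [Fact p.Prime] [CharP K p] (v : AddValuation K (WithTop ℤ))
    {f : K} (hf : 0 < v f) (n : ℕ) :
    ((n : ℤ) : WithTop ℤ) < v (approxRoot p f (n + 1) - approxRoot p f n) := by
  have hp : 1 < p := (Fact.out : p.Prime).one_lt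
  refine v.natCast_lt_of_pow hp (x := fun n => approxRoot p f (n + 1) - approxRoot p f n) ?_ ?_ n
  · have hp0 : p ≠ 0 := by omega
    simpa [approxRoot, hp0, AddValuation.map_neg] using hf
  · intro n
    have h := sub_pow_char (approxRoot p f n ^ p - f) (approxRoot p f n)
    simp only [approxRoot]
    linear_combination -h

/-- Polynomial multiples of `X ^ p - X - C f` tend to `0` along the approximate roots. -/
lemma eventually_lt_map_eval_approxRoot [Fact p.Prime] [CharP K p]
    (v : AddValuation K (WithTop ℤ)) {f : K} (hf : 0 < v f) {g : K[X]}
    (hg : X ^ p - X - C f ∣ g) (N : ℤ) :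
    ∀ᶠ n in Filter.atTop, (N : WithTop ℤ) < v (g.eval (approxRoot p f n)) := by
  have hp : 1 < p := (Fact.out : p.Prime).one_lt
  obtain ⟨h, rfl⟩ := hg
  obtain ⟨B, hB⟩ := v.exists_le_map_eval h
  filter_upwards [Filter.eventually_ge_atTop (N - B).toNat] with n hn
  have h1 := lt_map_approxRoot_succ_sub v hf n
  have h2 := hB _ (map_approxRoot_pos v hp hf n).le
  have h3 : (X ^ p - X - C f : K[X]).eval (approxRoot p f n) =
      approxRoot p f (n + 1) - approxRoot p f n := by
    simp only [approxRoot, eval_sub, eval_pow, eval_X, eval_C]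
    ring
  rw [eval_mul, AddValuation.map_mul, h3]
  have h4 : (N : WithTop ℤ) ≤ ((n : ℤ) : WithTop ℤ) + B := by
    norm_cast
    omega
  calc (N : WithTop ℤ) ≤ ((n : ℤ) : WithTop ℤ) + B := h4
    _ < v (approxRoot p f (n + 1) - approxRoot p f n) + B :=
      WithTop.add_lt_add_right (WithTop.coe_ne_top) h1
    _ ≤ _ := by gcongr

/-- The values of a polynomial not divisible by `X ^ p - X - C f` are eventually constant along
the approximate roots. -/
lemma exists_eventually_map_eval_approxRoot_eq [Fact p.Prime] [CharP K p]
    (v : AddValuation K (WithTop ℤ)) {f : K} (hf : 0 < v f) {b : L}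
    (hb : minpoly K b = X ^ p - X - C f) (hsurj : ∀ y : L, ∃ g : K[X], aeval b g = y)
    {y : L} (hy : y ≠ 0) :
    ∃ k : ℤ, ∀ g : K[X], aeval b g = y →
      ∀ᶠ n in Filter.atTop, v (g.eval (approxRoot p f n)) = k := by
  have hp : 1 < p := (Fact.out : p.Prime).one_lt
  have hpos := map_approxRoot_pos v hp hf
  have hlim : ∀ g : K[X], aeval b g = 0 → ∀ N : ℤ,
      ∀ᶠ n in Filter.atTop, (N : WithTop ℤ) < v (g.eval (approxRoot p f n)) :=
    fun g hg => eventually_lt_map_eval_approxRoot v hf (hb ▸ minpoly.dvd K b hg)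
  obtain ⟨g, hg⟩ := hsurj y
  obtain ⟨u, hu⟩ := hsurj y⁻¹
  obtain ⟨B, hB⟩ := v.exists_le_map_eval u
  obtain ⟨C, hC⟩ := v.exists_le_map_eval_sub_eval g
  have hinv : ∀ᶠ n in Filter.atTop,
      v (g.eval (approxRoot p f n)) + v (u.eval (approxRoot p f n)) = 0 := by
    filter_upwards [hlim (g * u - 1) (by simp [hg, hu, hy]) 0] with n hn
    rw [eval_sub, eval_mul, eval_one, WithTop.coe_zero, ← AddValuation.map_one v] at hn
    rw [← AddValuation.map_mul]
    exact (AddValuation.map_eq_of_lt_sub v hn).trans (AddValuation.map_one v)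
  have hle : ∀ᶠ n in Filter.atTop, v (g.eval (approxRoot p f n)) ≤ (-B : ℤ) := by
    filter_upwards [hinv] with n hn
    have h1 := hB _ (hpos n).le
    generalize v (g.eval (approxRoot p f n)) = s at *
    generalize v (u.eval (approxRoot p f n)) = t at *
    induction s with
    | top => simp at hn
    | coe s =>
      induction t with
      | top => simp at hn
      | coe t =>
        norm_cast at *
        omega
  have hstep : ∀ᶠ n in Filter.atTop,
      v (g.eval (approxRoot p f (n + 1))) = v (g.eval (approxRoot p f n)) := by
    filter_upwards [hle, Filter.eventually_ge_atTop (-B - C).toNat] with n hn hn'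
    apply AddValuation.map_eq_of_lt_sub
    refine hn.trans_lt (lt_of_lt_of_le ?_ (hC _ _ (hpos _).le (hpos _).le))
    calc ((-B : ℤ) : WithTop ℤ) ≤ C + ((n : ℤ) : WithTop ℤ) := by
          norm_cast
          omega
      _ < _ := WithTop.add_lt_add_left WithTop.coe_ne_top (lt_map_approxRoot_succ_sub v hf n)
  obtain ⟨m, hm⟩ := Filter.eventually_atTop.1 (hstep.and hle)
  have hconst : ∀ n ≥ m, v (g.eval (approxRoot p f n)) = v (g.eval (approxRoot p f m)) := by
    intro n hn
    induction n, hn using Nat.le_induction with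
    | base => rfl
    | succ n hn ih => exact (hm n hn).1.trans ih
  obtain ⟨k, hk⟩ := WithTop.ne_top_iff_exists.1
    (ne_top_of_le_ne_top WithTop.coe_ne_top (hm m le_rfl).2)
  refine ⟨k, fun h hh => ?_⟩
  filter_upwards [Filter.eventually_ge_atTop m, hlim (h - g) (by simp [hg, hh]) k] with n hn hlt
  rw [eval_sub] at hlt
  have h1 : v (g.eval (approxRoot p f n)) = k := (hconst n hn).trans hk.symm
  rw [← h1] at hlt ⊢
  exact AddValuation.map_eq_of_lt_sub v hlt

/-- An extension of `v` to `K(b)` for which the root `b` of `X ^ p - X - C f` is not a unit. -/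
lemma exists_extension [Fact p.Prime] [CharP K p]
    (v : AddValuation K (WithTop ℤ)) {f : K} (hf : 0 < v f) {b : L}
    (hb : minpoly K b = X ^ p - X - C f) (hsurj : ∀ y : L, ∃ g : K[X], aeval b g = y) :
    ∃ w : AddValuation L (WithTop ℤ), ExtendsWith v w 1 ∧ 0 < w b := by
  classical
  have hp : 1 < p := (Fact.out : p.Prime).one_lt
  choose! k hk using fun (y : L) (hy : y ≠ 0) =>
    exists_eventually_map_eval_approxRoot_eq v hf hb hsurj hy
  choose g hg using hsurj
  have hk' : ∀ y : L, y ≠ 0 → ∀ h : K[X], aeval b h = y →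
      ∃ n, v (h.eval (approxRoot p f n)) = k y := fun y hy h hh => (hk y hy h hh).exists
  let w : L → WithTop ℤ := fun y => if y = 0 then ⊤ else (k y : WithTop ℤ)
  have hw : ∀ y, y ≠ 0 → w y = k y := fun y hy => if_neg hy
  have hw0 : w 0 = ⊤ := if_pos rfl
  have hC : ∀ (x : K) (n : ℤ), v x = n → w (algebraMap K L x) = n := by
    intro x n hn
    have hx : x ≠ 0 := by
      rintro rfl
      simp at hn
    have hx' : algebraMap K L x ≠ 0 := by simpa using hx
    obtain ⟨m, hm⟩ := hk' _ hx' (C x) (by simp)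
    rw [hw _ hx', ← hm, eval_C, hn]
  refine ⟨AddValuation.of w hw0 ?_ ?_ ?_, ?_, ?_⟩
  · simpa using hC 1 0 (by simp)
  · intro x y
    by_cases hx : x = 0
    · simp [hx, hw0]
    by_cases hy : y = 0
    · simp [hy, hw0]
    by_cases hxy : x + y = 0
    · simp [hxy, hw0]
    obtain ⟨n, h1, h2, h3⟩ := ((hk x hx _ (hg x)).and ((hk y hy _ (hg y)).and
      (hk (x + y) hxy (g x + g y) (by simp [hg])))).exists
    rw [hw x hx, hw y hy, hw _ hxy, ← h1, ← h2, ← h3, eval_add]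
    exact AddValuation.map_add v _ _
  · intro x y
    by_cases hx : x = 0
    · simp [hx, hw0]
    by_cases hy : y = 0
    · simp [hy, hw0]
    have hxy := mul_ne_zero hx hy
    obtain ⟨n, h1, h2, h3⟩ := ((hk x hx _ (hg x)).and ((hk y hy _ (hg y)).and
      (hk (x * y) hxy (g x * g y) (by simp [hg])))).exists
    rw [hw x hx, hw y hy, hw _ hxy, ← h1, ← h2, ← h3, eval_mul]
    exact AddValuation.map_mul v _ _
  · intro x n hn
    rw [one_mul]
    exact hC x n hn
  · rw [AddValuation.of_apply]
    by_cases hb0 : b = 0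
    · simp [hb0, hw0]
    obtain ⟨n, hn⟩ := hk' b hb0 X (by simp)
    rw [hw b hb0, ← hn, eval_X]
    exact map_approxRoot_pos v hp hf n

/-- `K` is dense in `K(b)` for any extension of `v` for which `b` is not a unit. -/
lemma exists_lt_map_sub_algebraMap [Fact p.Prime] [CharP K p] [CharP L p]
    {v : AddValuation K (WithTop ℤ)} {w : AddValuation L (WithTop ℤ)} {e : ℤ} (he : 0 < e)
    (hvw : ExtendsWith v w e) {f : K} (hf : 0 < v f) {b : L} (hb : b ^ p - b = algebraMap K L f)
    (hwb : 0 < w b) (g : K[X]) (N : ℤ) :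
    ∀ᶠ n in Filter.atTop,
      (N : WithTop ℤ) < w (aeval b g - algebraMap K L (g.eval (approxRoot p f n))) := by
  have hp : 1 < p := (Fact.out : p.Prime).one_lt
  obtain ⟨B, hB⟩ := w.exists_le_map_eval_sub_eval (g.map (algebraMap K L))
  filter_upwards [Filter.eventually_ge_atTop (N - B).toNat] with n hn
  have h1 := hB b (algebraMap K L (approxRoot p f n)) hwb.le
    ((hvw.nonneg_iff he _).2 (map_approxRoot_pos v hp hf n).le)
  rw [eval_map_apply, eval_map_algebraMap] at h1
  refine lt_of_lt_of_le ?_ h1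
  have h2 := w.natCast_lt_of_pow hp (x := fun n => b - algebraMap K L (approxRoot p f n))
    (by simpa [approxRoot] using hwb) (fun n => by
      simp only [approxRoot]
      rw [sub_pow_char, map_sub, map_pow, ← hb]
      ring) n
  calc (N : WithTop ℤ) ≤ B + ((n : ℤ) : WithTop ℤ) := by
        norm_cast
        omega
    _ < _ := WithTop.add_lt_add_left WithTop.coe_ne_top h2

/-- An extension of `v` is determined by the root of `X ^ p - X - C f` that is not a unit. -/
lemma extension_unique [Fact p.Prime] [CharP K p] [CharP L p]
    {v : AddValuation K (WithTop ℤ)} {w w' : AddValuation L (WithTop ℤ)}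
    (hw : ExtendsWith v w 1) (hw' : ExtendsWith v w' 1) {f : K} (hf : 0 < v f) {b : L}
    (hb : b ^ p - b = algebraMap K L f) (hsurj : ∀ y : L, ∃ g : K[X], aeval b g = y)
    (hwb : 0 < w b) (hwb' : 0 < w' b) : w = w' := by
  apply AddValuation.ext
  intro y
  by_cases hy : y = 0
  · simp [hy]
  obtain ⟨k, hk⟩ := w.exists_int_eq hy
  obtain ⟨k', hk'⟩ := w'.exists_int_eq hy
  obtain ⟨g, rfl⟩ := hsurj y
  obtain ⟨n, h, h'⟩ := ((exists_lt_map_sub_algebraMap one_pos hw hf hb hwb g k).and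
    (exists_lt_map_sub_algebraMap one_pos hw' hf hb hwb' g k')).exists
  rw [← hk, AddValuation.map_sub_swap] at h
  rw [← hk', AddValuation.map_sub_swap] at h'
  rw [← AddValuation.map_eq_of_lt_sub w h, ← AddValuation.map_eq_of_lt_sub w' h']
  by_cases hx : g.eval (approxRoot p f n) = 0
  · simp [hx]
  obtain ⟨m, hm⟩ := v.exists_int_eq hx
  rw [hw _ m hm, hw' _ m hm]

/-- Some root of `X ^ p - X - C f` has positive valuation as soon as `f` does. -/
lemma exists_root_map_pos [Fact p.Prime] {w : AddValuation L (WithTop ℤ)} {f : K}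
    (hsplit : ((X ^ p - X - C f : K[X]).map (algebraMap K L)).Splits)
    (hf : 0 < w (algebraMap K L f)) :
    ∃ b : L, b ^ p - b = algebraMap K L f ∧ 0 < w b := by
  have hp : 1 < p := (Fact.out : p.Prime).one_lt
  have hmon : (X ^ p - X - C f : K[X]).Monic := monic_X_pow_sub_X_sub_C f hp
  have h := hsplit.coeff_zero_eq_prod_roots_of_monic (hmon.map _)
  have h1 : w ((X ^ p - X - C f : K[X]).map (algebraMap K L)).roots.prod =
      w (algebraMap K L f) := by
    have h2 := congrArg w h
    have hp0 : p ≠ 0 := by omega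
    rw [AddValuation.map_mul, AddValuation.map_pow, AddValuation.map_neg,
      AddValuation.map_one, nsmul_zero, zero_add] at h2
    rw [← h2, coeff_zero_eq_eval_zero]
    simp [hp0, AddValuation.map_neg]
  obtain ⟨r, hr, hr'⟩ := w.exists_pos_of_multiset_prod _ (h1 ▸ hf)
  have h3 := (mem_roots'.1 hr).2
  simp only [IsRoot, Polynomial.map_sub, Polynomial.map_pow, map_X, map_C, eval_sub, eval_pow,
    eval_X, eval_C] at h3
  exact ⟨r, sub_eq_zero.1 h3, hr'⟩

end ArtinSchreierValuation

/-- Let `K` have characteristic `p > 0` with normalized discrete valuation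
`v`.  Let `f ∈ K` with `v(f) > 0` such that `T^p - T - f` has no root in `K`, and let
`L = K_{℘,f}` be its splitting field.  Then every (normalized) extension `v_L` of `v` to `L`
has `e(v_L|v) = 1` and `f(v_L|v) = 1`, and there are exactly `p` distinct such extensions. -/
theorem statement_8 (p : ℕ) (hp : p.Prime) (K : Type) [Field K] [CharP K p]
    (v : AddValuation K (WithTop ℤ)) (hv : IsNormalizedVal v)
    (f : K) (hf : (0 : WithTop ℤ) < v f) (hirr : ∀ x : K, x ^ p - x ≠ f)
    (L : Type) [Field L] [Algebra K L]
    (hL : Polynomial.IsSplittingField K L (Polynomial.X ^ p - Polynomial.X - Polynomial.C f)) :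
    (∀ w : AddValuation L (WithTop ℤ), IsNormExtension v w →
        ExtendsWith v w 1 ∧ ResidueDegreeOne v w) ∧
      {w : AddValuation L (WithTop ℤ) | IsNormExtension v w}.ncard = p := by
  have : Fact p.Prime := ⟨hp⟩
  have : CharP L p := charP_of_injective_algebraMap (algebraMap K L).injective p
  have hp1 := hp.one_lt
  have hmin : ∀ b : L, b ^ p - b = algebraMap K L f → minpoly K b = X ^ p - X - C f :=
    fun b hb => minpoly_eq_of_pow_sub_self hirr hL.splits hb
  have hsurj : ∀ b : L, b ^ p - b = algebraMap K L f → ∀ y : L, ∃ g : K[X], aeval b g = y :=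
    fun b hb => aeval_surjective_of_pow_sub_self hL hb
  have hroot : ∀ w : AddValuation L (WithTop ℤ), IsNormExtension v w →
      ∃ b : L, b ^ p - b = algebraMap K L f ∧ 0 < w b :=
    fun w ⟨_, e, he, hvw⟩ => exists_root_map_pos hL.splits ((hvw.pos_iff he f).2 hf)
  have hone : ∀ w : AddValuation L (WithTop ℤ), IsNormExtension v w → ExtendsWith v w 1 := by
    rintro w hw
    obtain ⟨b, hb, hwb⟩ := hroot w hw
    obtain ⟨hnorm, e, he, hvw⟩ := hw
    obtain ⟨y, hy⟩ := hnorm 1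
    obtain ⟨g, rfl⟩ := hsurj b hb y
    obtain ⟨n, hn⟩ := (exists_lt_map_sub_algebraMap he hvw hf hb hwb g 1).exists
    rw [← hy, AddValuation.map_sub_swap] at hn
    have h1 := (AddValuation.map_eq_of_lt_sub w hn).trans hy
    have h0 : g.eval (approxRoot p f n) ≠ 0 := by
      intro h
      rw [h] at h1
      simp at h1
    obtain ⟨k, hk⟩ := v.exists_int_eq h0
    rw [hvw _ k hk] at h1
    have h2 : e * k = 1 := by exact_mod_cast h1
    rwa [Int.eq_one_of_mul_eq_one_right he.le h2] at hvw
  refine ⟨fun w hw => ⟨hone w hw, fun y hy => ?_⟩, ?_⟩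
  · obtain ⟨b, hb, hwb⟩ := hroot w hw
    obtain ⟨g, rfl⟩ := hsurj b hb y
    obtain ⟨n, hn⟩ :=
      (exists_lt_map_sub_algebraMap one_pos (hone w hw) hf hb hwb g 0).exists
    refine ⟨g.eval (approxRoot p f n), ?_, hn⟩
    rw [← (hone w hw).nonneg_iff one_pos]
    have h := AddValuation.map_le_sub w hy hn.le
    rwa [sub_sub_cancel] at h
  · have hex : ∀ b : L, b ^ p - b = algebraMap K L f →
        ∃ w : AddValuation L (WithTop ℤ), IsNormExtension v w ∧ 0 < w b := by
      intro b hb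
      obtain ⟨w, hvw, hwb⟩ := exists_extension v hf (hmin b hb) (hsurj b hb)
      refine ⟨w, ⟨fun n => ?_, 1, one_pos, hvw⟩, hwb⟩
      obtain ⟨x, hx⟩ := hv n
      exact ⟨algebraMap K L x, by rw [hvw x n hx, one_mul]⟩
    choose W hW hWb using hex
    rw [← ncard_pow_sub_self hL.splits]
    symm
    refine Set.ncard_congr W hW ?_ ?_
    · intro b c hb hc hbc
      by_contra hne
      refine (W b hb).map_pow_ne_self hp1 (sub_ne_zero.2 hne) ?_
        (sub_pow_eq_sub_of_pow_sub_self hb hc)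
      rw [sub_eq_add_neg]
      refine AddValuation.map_lt_add _ (hWb b hb) ?_
      rw [AddValuation.map_neg, show W b hb = W c hc from hbc]
      exact hWb c hc
    · intro w hw
      obtain ⟨b, hb, hwb⟩ := hroot w hw
      exact ⟨b, hb, extension_unique (hone _ (hW b hb)) (hone w hw) hf hb (hsurj b hb)
        (hWb b hb) hwb⟩
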